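/- arXiv:1408.1419 — 5 statements merged into one kernel-verified Lean document; each statement's English description precedes it below -/
import Mathlib

section
/- Let k ≥ 1, 0 ≤ ν ≤ k, and let J be the diagonal k×k matrix diag(-1,…,-1,1,…,1) with k−ν entries equal to −1 followed by ν entries equal to 1. Let S : [0,1] → M_k(ℝ) be a C¹ family of symmetric matrices with derivative S', let δ ∈ ℝ and r₀ ∈ (0,1]. Suppose u : [0,1] → ℝ^k is C² and satisfies (1/r₀²)·J·u''(x) + S(r₀·x)·u(x) + δ·u(x) = 0 for all x ∈ [0,1] together with u(0) = u(1) = 0. Then −(2/r₀³)·∫₀¹ ⟨J·u''(x), u(x)⟩ dx + ∫₀¹ x·⟨S'(r₀·x)·u(x), u(x)⟩ dx = (1/r₀³)·⟨J·u'(1), u'(1)⟩. -/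
open Set Matrix
set_option maxHeartbeats 400000

lemma aux_dot {k : ℕ} {f g : ℝ → Fin k → ℝ} {f' g' : Fin k → ℝ} {s : Set ℝ} {x : ℝ}
    (hf : HasDerivWithinAt f f' s x) (hg : HasDerivWithinAt g g' s x) :
    HasDerivWithinAt (fun t => f t ⬝ᵥ g t) (f' ⬝ᵥ g x + f x ⬝ᵥ g') s x := by
  rw [hasDerivWithinAt_pi] at hf hg
  simp only [dotProduct, ← Finset.sum_add_distrib]
  exact HasDerivWithinAt.fun_sum fun i _ => (hf i).mul (hg i)

lemma aux_mv {k : ℕ} {M : ℝ → Matrix (Fin k) (Fin k) ℝ} {M' : Matrix (Fin k) (Fin k) ℝ}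
    {g : ℝ → Fin k → ℝ} {g' : Fin k → ℝ} {s : Set ℝ} {x : ℝ}
    (hM : ∀ i j, HasDerivWithinAt (fun t => M t i j) (M' i j) s x)
    (hg : HasDerivWithinAt g g' s x) :
    HasDerivWithinAt (fun t => (M t).mulVec (g t)) (M'.mulVec (g x) + (M x).mulVec g') s x := by
  rw [hasDerivWithinAt_pi]
  intro i
  exact aux_dot (f := fun t => M t i) (f' := M' i) (hasDerivWithinAt_pi.2 (hM i)) hg

lemma aux_comp {φ : ℝ → ℝ} {a r : ℝ} {s : Set ℝ} {x : ℝ}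
    (h : HasDerivWithinAt φ a s (r * x))
    (h1 : HasDerivWithinAt (fun t : ℝ => r * t) r s x) (hm : MapsTo (fun t => r * t) s s) :
    HasDerivWithinAt (fun t => φ (r * t)) (r * a) s x := by
  rw [mul_comm r a]
  exact HasDerivWithinAt.comp (h₂ := φ) (h := fun t => r * t) x h h1 hm

lemma aux_cont {k : ℕ} {M : ℝ → Matrix (Fin k) (Fin k) ℝ} {f g : ℝ → Fin k → ℝ} {s : Set ℝ}
    (hM : ContinuousOn M s) (hf : ContinuousOn f s) (hg : ContinuousOn g s) :
    ContinuousOn (fun x => (M x).mulVec (f x) ⬝ᵥ g x) s := by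
  rw [continuousOn_iff_continuous_restrict] at *
  exact Continuous.dotProduct (Continuous.matrix_mulVec hM hf) hg

lemma aux_symm {k : ℕ} {M : Matrix (Fin k) (Fin k) ℝ} (h : M.IsSymm) (a b : Fin k → ℝ) :
    M.mulVec a ⬝ᵥ b = M.mulVec b ⬝ᵥ a := by
  rw [dotProduct_comm, dotProduct_mulVec, ← mulVec_transpose, h.eq]

/-- the crossing-form identity in the one-dimensional case: for a solution `u`
of `(1/r₀²)Ju'' + S(r₀·)u + δu = 0` with Dirichlet boundary conditions,
`−(2/r₀³)∫⟨Ju'',u⟩ + ∫ x⟨S'(r₀x)u,u⟩ = (1/r₀³)⟨Ju'(1),u'(1)⟩`. -/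
theorem stmt_1 (k ν : ℕ) (hk : 1 ≤ k) (hν : ν ≤ k)
    (J : Matrix (Fin k) (Fin k) ℝ)
    (hJ : J = Matrix.diagonal fun i : Fin k => if (i : ℕ) < k - ν then (-1 : ℝ) else 1)
    (S S' : ℝ → Matrix (Fin k) (Fin k) ℝ)
    (hSsymm : ∀ x ∈ Icc (0:ℝ) 1, (S x).IsSymm)
    (hS : ∀ x ∈ Icc (0:ℝ) 1, ∀ i j : Fin k,
      HasDerivWithinAt (fun t => S t i j) (S' x i j) (Icc 0 1) x)
    (hS'cont : ContinuousOn S' (Icc 0 1))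
    (δ r₀ : ℝ) (hr₀ : r₀ ∈ Ioc (0:ℝ) 1)
    (u u' u'' : ℝ → Fin k → ℝ)
    (hu : ∀ x ∈ Icc (0:ℝ) 1, HasDerivWithinAt u (u' x) (Icc 0 1) x)
    (hu' : ∀ x ∈ Icc (0:ℝ) 1, HasDerivWithinAt u' (u'' x) (Icc 0 1) x)
    (hu''c : ContinuousOn u'' (Icc 0 1))
    (hode : ∀ x ∈ Icc (0:ℝ) 1,
      (1 / r₀ ^ 2) • J.mulVec (u'' x) + (S (r₀ * x)).mulVec (u x) + δ • u x = 0)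
    (hu0 : u 0 = 0) (hu1 : u 1 = 0) :
    -(2 / r₀ ^ 3) * (∫ x in (0:ℝ)..1, J.mulVec (u'' x) ⬝ᵥ u x)
      + (∫ x in (0:ℝ)..1, x * ((S' (r₀ * x)).mulVec (u x) ⬝ᵥ u x))
      = (1 / r₀ ^ 3) * (J.mulVec (u' 1) ⬝ᵥ u' 1) := by
  obtain ⟨hr, hr1⟩ := hr₀
  have hrne : r₀ ≠ 0 := hr.ne'
  have hJs : J.IsSymm := by rw [hJ]; exact isSymm_diagonal _
  have hmaps : MapsTo (fun x => r₀ * x) (Icc (0:ℝ) 1) (Icc 0 1) := by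
    intro x hx
    exact ⟨mul_nonneg hr.le hx.1, mul_le_one₀ hr1 hx.1 hx.2⟩
  have huc : ContinuousOn u (Icc 0 1) := fun x hx => (hu x hx).continuousWithinAt
  have hc1 : ContinuousOn (fun x => J.mulVec (u'' x) ⬝ᵥ u x) (Icc 0 1) :=
    aux_cont continuousOn_const hu''c huc
  have hc2 : ContinuousOn (fun x => x * ((S' (r₀ * x)).mulVec (u x) ⬝ᵥ u x)) (Icc 0 1) := by
    refine continuousOn_id.mul ?_
    have h1 : ContinuousOn (fun x => S' (r₀ * x)) (Icc 0 1) :=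
      ContinuousOn.comp (g := S') (f := fun x => r₀ * x) hS'cont
        (continuous_const.mul continuous_id).continuousOn hmaps
    exact aux_cont h1 huc huc
  have hi1 : IntervalIntegrable (fun x => J.mulVec (u'' x) ⬝ᵥ u x) MeasureTheory.volume 0 1 :=
    ContinuousOn.intervalIntegrable_of_Icc zero_le_one hc1
  have hi2 : IntervalIntegrable (fun x => x * ((S' (r₀ * x)).mulVec (u x) ⬝ᵥ u x))
      MeasureTheory.volume 0 1 :=
    ContinuousOn.intervalIntegrable_of_Icc zero_le_one hc2
  have hJd : ∀ x, ∀ i j : Fin k, HasDerivWithinAt (fun _ : ℝ => J i j)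
      ((0 : Matrix (Fin k) (Fin k) ℝ) i j) (Icc 0 1) x :=
    fun x i j => hasDerivWithinAt_const _ _ _
  have key : ∀ x ∈ Icc (0:ℝ) 1, HasDerivWithinAt
      (fun t => (1 / r₀) * (t * ((S (r₀ * t)).mulVec (u t) ⬝ᵥ u t + δ * (u t ⬝ᵥ u t)))
        + (1 / r₀ ^ 3) * (t * (J.mulVec (u' t) ⬝ᵥ u' t) - J.mulVec (u' t) ⬝ᵥ u t))
      (-(2 / r₀ ^ 3) * (J.mulVec (u'' x) ⬝ᵥ u x)
        + x * ((S' (r₀ * x)).mulVec (u x) ⬝ᵥ u x)) (Icc 0 1) x := by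
    intro x hx
    have hSd : ∀ i j : Fin k, HasDerivWithinAt (fun t => S (r₀ * t) i j)
        ((r₀ • S' (r₀ * x)) i j) (Icc 0 1) x := by
      intro i j
      have h1 : HasDerivWithinAt (fun t : ℝ => r₀ * t) r₀ (Icc 0 1) x := by
        simpa using (hasDerivWithinAt_id x (Icc (0:ℝ) 1)).const_mul r₀
      exact aux_comp (φ := fun t => S t i j) (hS (r₀ * x) (hmaps hx) i j) h1 hmaps
    have hux := hu x hx
    have hu'x := hu' x hx
    have d1 := aux_dot (aux_mv hSd hux) hux
    have d2 := aux_dot hux hux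
    have d3 := aux_dot (aux_mv (hJd x) hu'x) hu'x
    have d4 := aux_dot (aux_mv (hJd x) hu'x) hux
    have hid := hasDerivWithinAt_id x (Icc (0:ℝ) 1)
    have D := ((hid.mul (d1.add (d2.const_mul δ))).const_mul (1 / r₀)).add
      (((hid.mul d3).sub d4).const_mul (1 / r₀ ^ 3))
    refine D.congr_deriv ?_
    have o := hode x hx
    have o1 := congrArg (fun v => v ⬝ᵥ u x) o
    have o2 := congrArg (fun v => v ⬝ᵥ u' x) o
    simp only [add_dotProduct, smul_dotProduct, zero_dotProduct, smul_eq_mul] at o1 o2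
    have s1 := aux_symm (hSsymm _ (hmaps hx)) (u' x) (u x)
    have s2 := aux_symm hJs (u' x) (u'' x)
    have s3 := dotProduct_comm (u' x) (u x)
    simp only [add_dotProduct, smul_dotProduct, zero_dotProduct, smul_eq_mul, zero_mulVec,
      smul_mulVec, s1, s2, s3, id, Pi.add_apply] at o1 o2 ⊢
    generalize J.mulVec (u'' x) ⬝ᵥ u x = a at *
    generalize J.mulVec (u'' x) ⬝ᵥ u' x = b at *
    generalize J.mulVec (u' x) ⬝ᵥ u' x = c at *
    generalize (S (r₀ * x)).mulVec (u x) ⬝ᵥ u x = d at *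
    generalize (S (r₀ * x)).mulVec (u x) ⬝ᵥ u' x = e at *
    have e1 : d = -(1 / r₀ ^ 2 * a) - δ * (u x ⬝ᵥ u x) := by linarith
    have e2 : e = -(1 / r₀ ^ 2 * b) - δ * (u x ⬝ᵥ u' x) := by linarith
    rw [e1, e2]
    field_simp
    ring
  have ftc := intervalIntegral.integral_eq_sub_of_hasDerivAt_of_le (zero_le_one (α := ℝ))
    (fun x hx => (key x hx).continuousWithinAt)
    (fun x hx => (key x (Ioo_subset_Icc_self hx)).hasDerivAt (Icc_mem_nhds hx.1 hx.2))
    ((hi1.const_mul _).add hi2)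
  rw [intervalIntegral.integral_add (hi1.const_mul _) hi2,
    intervalIntegral.integral_const_mul] at ftc
  rw [ftc]
  simp [hu0, hu1]
end

section
/- Let k ≥ 1, let S : [0,1] → M_k(ℝ) be a C¹ family of symmetric matrices with derivative S', and let r₀ ∈ (0,1]. Suppose u : [0,1] → ℝ^k is C², not identically zero, and satisfies −(1/r₀²)·u''(x) + S(r₀·x)·u(x) = 0 for all x ∈ [0,1] together with u(0) = u(1) = 0. Then (2/r₀³)·∫₀¹ ⟨u''(x), u(x)⟩ dx + ∫₀¹ x·⟨S'(r₀·x)·u(x), u(x)⟩ dx = −(1/r₀³)·‖u'(1)‖², and this quantity is strictly negative. -/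
open Set Matrix

lemma aux_mulVec {k : ℕ} {A : ℝ → Matrix (Fin k) (Fin k) ℝ} {A' : Matrix (Fin k) (Fin k) ℝ}
    {g : ℝ → Fin k → ℝ} {g' : Fin k → ℝ} {s : Set ℝ} {x : ℝ}
    (hA : ∀ i j, HasDerivWithinAt (fun t => A t i j) (A' i j) s x)
    (hg : HasDerivWithinAt g g' s x) :
    HasDerivWithinAt (fun t => (A t).mulVec (g t)) (A'.mulVec (g x) + (A x).mulVec g') s x := by
  rw [hasDerivWithinAt_pi]
  intro i
  exact aux_dot (f := fun t => A t i) (f' := A' i) (hasDerivWithinAt_pi.2 (hA i)) hg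

lemma aux_bound {k : ℕ} (A : ℝ → Matrix (Fin k) (Fin k) ℝ)
    (hA : ∀ i j, ContinuousOn (fun t => A t i j) (Icc 0 1)) :
    ∃ C : ℝ, 0 ≤ C ∧ ∀ t ∈ Icc (0:ℝ) 1, ∀ v, ‖(A t).mulVec v‖ ≤ C * ‖v‖ := by
  have hc : ContinuousOn (fun t => ∑ i, ∑ j, |A t i j|) (Icc (0:ℝ) 1) :=
    continuousOn_finsetSum _ fun i _ => continuousOn_finsetSum _ fun j _ => (hA i j).abs
  obtain ⟨C, hC⟩ := isCompact_Icc.bddAbove_image hc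
  have hC' : ∀ t ∈ Icc (0:ℝ) 1, ∑ i, ∑ j, |A t i j| ≤ C := fun t ht => hC ⟨t, ht, rfl⟩
  have hC0 : 0 ≤ C := le_trans (by positivity) (hC' 0 (by simp))
  refine ⟨C, hC0, fun t ht v => ?_⟩
  rw [pi_norm_le_iff_of_nonneg (by positivity)]
  intro i
  calc ‖(A t).mulVec v i‖ ≤ ∑ j, ‖A t i j * v j‖ := by
        simp only [Matrix.mulVec, dotProduct]
        exact norm_sum_le _ _
    _ ≤ ∑ j, |A t i j| * ‖v‖ := by
        refine Finset.sum_le_sum fun j _ => ?_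
        rw [norm_mul, Real.norm_eq_abs]
        exact mul_le_mul_of_nonneg_left (norm_le_pi_norm v j) (abs_nonneg _)
    _ = (∑ j, |A t i j|) * ‖v‖ := by rw [Finset.sum_mul]
    _ ≤ C * ‖v‖ := by
        refine mul_le_mul_of_nonneg_right (le_trans ?_ (hC' t ht)) (norm_nonneg _)
        exact Finset.single_le_sum (f := fun i => ∑ j, |A t i j|)
          (fun i _ => by positivity) (Finset.mem_univ i)

lemma aux_unique {k : ℕ} (A : ℝ → Matrix (Fin k) (Fin k) ℝ)
    (hA : ∀ i j, ContinuousOn (fun t => A t i j) (Icc 0 1))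
    (u u' : ℝ → Fin k → ℝ)
    (hu : ∀ x ∈ Icc (0:ℝ) 1, HasDerivWithinAt u (u' x) (Icc 0 1) x)
    (hu' : ∀ x ∈ Icc (0:ℝ) 1, HasDerivWithinAt u' ((A x).mulVec (u x)) (Icc 0 1) x)
    (h1 : u 1 = 0) (h1' : u' 1 = 0) : ∀ x ∈ Icc (0:ℝ) 1, u x = 0 := by
  obtain ⟨C, hC0, hC⟩ := aux_bound A hA
  let v : ℝ → (Fin k → ℝ) × (Fin k → ℝ) → (Fin k → ℝ) × (Fin k → ℝ) :=
    fun t p => (p.2, (A t).mulVec p.1)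
  have hv : ∀ t ∈ Ioc (0:ℝ) 1, LipschitzOnWith (Real.toNNReal (max 1 C)) (v t) univ := by
    intro t ht
    refine LipschitzOnWith.of_dist_le_mul fun p _ q _ => ?_
    rw [Real.coe_toNNReal _ (le_trans zero_le_one (le_max_left _ _)), dist_eq_norm, dist_eq_norm]
    have e : v t p - v t q = ((p - q).2, (A t).mulVec (p - q).1) := by
      simp [v, Matrix.mulVec_sub]
    rw [e, Prod.norm_mk]
    refine max_le ?_ ?_
    · calc ‖(p - q).2‖ ≤ 1 * ‖p - q‖ := by rw [one_mul]; exact norm_snd_le _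
        _ ≤ _ := mul_le_mul_of_nonneg_right (le_max_left _ _) (norm_nonneg _)
    · calc _ ≤ C * ‖(p - q).1‖ := hC t (Ioc_subset_Icc_self ht) _
        _ ≤ C * ‖p - q‖ := mul_le_mul_of_nonneg_left (norm_fst_le _) hC0
        _ ≤ _ := mul_le_mul_of_nonneg_right (le_max_right _ _) (norm_nonneg _)
  have hd : ∀ x ∈ Icc (0:ℝ) 1, HasDerivWithinAt (fun t => (u t, u' t)) (v x (u x, u' x))
      (Icc 0 1) x := fun x hx => (hu x hx).prodMk (hu' x hx)
  have key := ODE_solution_unique_of_mem_Icc_left (v := v) (s := fun _ => univ)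
    (f := fun t => (u t, u' t)) (g := fun _ => 0) (a := 0) (b := 1) hv
    (fun x hx => (hd x hx).continuousWithinAt)
    (fun x hx => (hd x (Ioc_subset_Icc_self hx)).mono_of_mem_nhdsWithin
      (Filter.mem_of_superset (Icc_mem_nhdsLE hx.1) (Icc_subset_Icc_right hx.2)))
    (fun _ _ => mem_univ _) continuousOn_const
    (fun x hx => by
      have : v x 0 = 0 := by simp [v]
      rw [this]; exact hasDerivWithinAt_const _ _ _)
    (fun _ _ => mem_univ _) (by simp [h1, h1'])
  intro x hx
  exact congrArg Prod.fst (key hx)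

/-- in the strongly elliptic case `J = -I`, the crossing form at a conjugate
radius `r₀` is given by the boundary term `−(1/r₀³)‖u'(1)‖²` and is strictly negative. -/
theorem stmt_2 (k : ℕ) (hk : 1 ≤ k)
    (S S' : ℝ → Matrix (Fin k) (Fin k) ℝ)
    (hSsymm : ∀ x ∈ Icc (0:ℝ) 1, (S x).IsSymm)
    (hS : ∀ x ∈ Icc (0:ℝ) 1, ∀ i j : Fin k,
      HasDerivWithinAt (fun t => S t i j) (S' x i j) (Icc 0 1) x)
    (hS'cont : ContinuousOn S' (Icc 0 1))
    (r₀ : ℝ) (hr₀ : r₀ ∈ Ioc (0:ℝ) 1)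
    (u u' u'' : ℝ → Fin k → ℝ)
    (hu : ∀ x ∈ Icc (0:ℝ) 1, HasDerivWithinAt u (u' x) (Icc 0 1) x)
    (hu' : ∀ x ∈ Icc (0:ℝ) 1, HasDerivWithinAt u' (u'' x) (Icc 0 1) x)
    (hu''c : ContinuousOn u'' (Icc 0 1))
    (hnontriv : ¬ ∀ x ∈ Icc (0:ℝ) 1, u x = 0)
    (hode : ∀ x ∈ Icc (0:ℝ) 1,
      -((1 / r₀ ^ 2) • u'' x) + (S (r₀ * x)).mulVec (u x) = 0)
    (hu0 : u 0 = 0) (hu1 : u 1 = 0) :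
    ((2 / r₀ ^ 3) * (∫ x in (0:ℝ)..1, u'' x ⬝ᵥ u x)
        + (∫ x in (0:ℝ)..1, x * ((S' (r₀ * x)).mulVec (u x) ⬝ᵥ u x))
      = -(1 / r₀ ^ 3) * (u' 1 ⬝ᵥ u' 1)) ∧
    (2 / r₀ ^ 3) * (∫ x in (0:ℝ)..1, u'' x ⬝ᵥ u x)
        + (∫ x in (0:ℝ)..1, x * ((S' (r₀ * x)).mulVec (u x) ⬝ᵥ u x)) < 0 := by
  obtain ⟨hr, hr1⟩ := hr₀
  have hmap : MapsTo (fun x : ℝ => r₀ * x) (Icc 0 1) (Icc 0 1) := fun x hx =>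
    ⟨mul_nonneg hr.le hx.1, mul_le_one₀ hr1 hx.1 hx.2⟩
  have hode' : ∀ x ∈ Icc (0:ℝ) 1, u'' x = r₀ ^ 2 • (S (r₀ * x)).mulVec (u x) := by
    intro x hx
    have e := hode x hx
    rw [neg_add_eq_zero] at e
    rw [← e, smul_smul]
    have : r₀ ^ 2 * (1 / r₀ ^ 2) = 1 := by field_simp
    rw [this, one_smul]
  have hA : ∀ x ∈ Icc (0:ℝ) 1, ∀ i j, HasDerivWithinAt (fun t => S (r₀ * t) i j)
      ((r₀ • S' (r₀ * x)) i j) (Icc 0 1) x := by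
    intro x hx i j
    have h := HasDerivWithinAt.scomp x (hS _ (hmap hx) i j)
      (((hasDerivWithinAt_id x (Icc (0:ℝ) 1)).const_mul r₀)) hmap
    refine (h.congr_deriv ?_)
    simp
  have huc : ContinuousOn u (Icc 0 1) := fun x hx => (hu x hx).continuousWithinAt
  have c1 : ContinuousOn (fun x => u'' x ⬝ᵥ u x) (Icc (0:ℝ) 1) :=
    continuousOn_finsetSum _ fun i _ =>
      ((continuousOn_pi.1 hu''c) i).mul ((continuousOn_pi.1 huc) i)
  have cS : ∀ i j, ContinuousOn (fun x => S' (r₀ * x) i j) (Icc (0:ℝ) 1) := fun i j =>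
    (continuousOn_pi.1 (continuousOn_pi.1 (hS'cont.comp (by fun_prop) hmap) i) j)
  have c2 : ContinuousOn (fun x => x * ((S' (r₀ * x)).mulVec (u x) ⬝ᵥ u x)) (Icc (0:ℝ) 1) :=
    continuousOn_id.mul (continuousOn_finsetSum _ fun i _ =>
      ContinuousOn.mul (f := fun x => (S' (r₀ * x)).mulVec (u x) i)
        (continuousOn_finsetSum (f := fun j x => S' (r₀ * x) i j * u x j) Finset.univ
          fun j _ => (cS i j).mul ((continuousOn_pi.1 huc) j))
        ((continuousOn_pi.1 huc) i))
  have i1 : IntervalIntegrable (fun x => u'' x ⬝ᵥ u x) MeasureTheory.volume 0 1 :=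
    ContinuousOn.intervalIntegrable_of_Icc zero_le_one c1
  have i2 : IntervalIntegrable (fun x => x * ((S' (r₀ * x)).mulVec (u x) ⬝ᵥ u x))
      MeasureTheory.volume 0 1 :=
    ContinuousOn.intervalIntegrable_of_Icc zero_le_one c2
  let G : ℝ → ℝ := fun x => x * (u' x ⬝ᵥ u' x - r₀ ^ 2 * ((S (r₀ * x)).mulVec (u x) ⬝ᵥ u x))
    - u' x ⬝ᵥ u x
  have hG : ∀ x ∈ Icc (0:ℝ) 1, HasDerivWithinAt G
      (-2 * (u'' x ⬝ᵥ u x) - r₀ ^ 3 * (x * ((S' (r₀ * x)).mulVec (u x) ⬝ᵥ u x)))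
      (Icc 0 1) x := by
    intro x hx
    have d := ((hasDerivWithinAt_id x (Icc (0:ℝ) 1)).mul
      ((aux_dot (hu' x hx) (hu' x hx)).sub
        ((aux_dot (aux_mulVec (hA x hx) (hu x hx)) (hu x hx)).const_mul (r₀ ^ 2)))).sub
      (aux_dot (hu' x hx) (hu x hx))
    refine d.congr_deriv ?_
    have sym : (S (r₀ * x)).mulVec (u' x) ⬝ᵥ u x = (S (r₀ * x)).mulVec (u x) ⬝ᵥ u' x := by
      rw [dotProduct_comm, dotProduct_mulVec, ← mulVec_transpose, (hSsymm _ (hmap hx)).eq]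
    rw [hode' x hx]
    simp only [id, add_dotProduct, smul_dotProduct, dotProduct_smul, smul_mulVec, smul_eq_mul, sym,
      dotProduct_comm (u' x) ((S (r₀ * x)).mulVec (u x)), Pi.sub_apply]
    ring
  have hint := intervalIntegral.integral_eq_sub_of_hasDerivAt_of_le zero_le_one
    (fun x hx => (hG x hx).continuousWithinAt)
    (fun x hx => (hG x (Ioo_subset_Icc_self hx)).hasDerivAt (Icc_mem_nhds hx.1 hx.2))
    ((i1.const_mul (-2)).sub (i2.const_mul (r₀ ^ 3)))
  rw [intervalIntegral.integral_sub (i1.const_mul (-2)) (i2.const_mul (r₀ ^ 3)),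
    intervalIntegral.integral_const_mul, intervalIntegral.integral_const_mul] at hint
  have hGv : G 1 - G 0 = u' 1 ⬝ᵥ u' 1 := by simp [G, hu0, hu1]
  rw [hGv] at hint
  have main : (2 / r₀ ^ 3) * (∫ x in (0:ℝ)..1, u'' x ⬝ᵥ u x)
        + (∫ x in (0:ℝ)..1, x * ((S' (r₀ * x)).mulVec (u x) ⬝ᵥ u x))
      = -(1 / r₀ ^ 3) * (u' 1 ⬝ᵥ u' 1) := by
    rw [← hint]
    field_simp
    ring
  refine ⟨main, ?_⟩
  rw [main]
  have hne : u' 1 ≠ 0 := by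
    intro h1'
    refine hnontriv (aux_unique (fun x => r₀ ^ 2 • S (r₀ * x)) (fun i j x hx => ?_) u u' hu
      (fun x hx => ?_) hu1 h1')
    · exact ((hA x hx i j).const_mul (r₀ ^ 2)).continuousWithinAt
    · have := hu' x hx
      rw [hode' x hx, ← smul_mulVec] at this
      exact this
  have hpos : 0 < u' 1 ⬝ᵥ u' 1 :=
    lt_of_le_of_ne (Finset.sum_nonneg fun i _ => mul_self_nonneg _)
      (fun h => hne (dotProduct_self_eq_zero.1 h.symm))
  have : 0 < 1 / r₀ ^ 3 * (u' 1 ⬝ᵥ u' 1) := by positivity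
  linarith
end

section
/- Let H be a real Hilbert space and A a densely defined symmetric linear operator on H with domain dom A, adjoint A† with domain dom A†, and set K = {u ∈ dom A† : A†u ∈ dom A† and A†(A†u) = −u}. Then for all u, v ∈ K one has ⟨A†u, v⟩ − ⟨u, A†v⟩ = ⟨A†u, v⟩ + ⟨A†(A†u), A†v⟩, and consequently the skew-symmetric form ω(u, v) = ⟨A†u, v⟩ − ⟨u, A†v⟩ is non-degenerate on K: if u ∈ K satisfies ω(u, v) = 0 for all v ∈ K, then u = 0. -/
open scoped RealInnerProductSpace

/-- on `K = {u ∈ dom A† : A†u ∈ dom A†, A†(A†u) = -u}` one has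
`⟨A†u,v⟩ - ⟨u,A†v⟩ = ⟨A†u,v⟩ + ⟨A†(A†u),A†v⟩`, and the skew-symmetric form
`ω(u,v) = ⟨A†u,v⟩ - ⟨u,A†v⟩` is non-degenerate on `K`. -/
theorem stmt_8 {H : Type*} [NormedAddCommGroup H] [InnerProductSpace ℝ H]
    [CompleteSpace H]
    (D : Submodule ℝ H) (A : D →ₗ[ℝ] H)
    (hdense : Dense (D : Set H))
    (hsymm : ∀ u v : D, ⟪A u, (v : H)⟫ = ⟪(u : H), A v⟫)
    (D' : Set H) (B' : H → H)
    (hdom : ∀ v : H, v ∈ D' ↔ ∃ C : ℝ, ∀ u : D, |⟪A u, v⟫| ≤ C * ‖(u : H)‖)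
    (hadj : ∀ u : D, ∀ v ∈ D', ⟪A u, v⟫ = ⟪(u : H), B' v⟫) :
    ∀ K : Set H, K = {x | x ∈ D' ∧ B' x ∈ D' ∧ B' (B' x) = -x} →
      (∀ u ∈ K, ∀ v ∈ K,
        ⟪B' u, v⟫ - ⟪u, B' v⟫ = ⟪B' u, v⟫ + ⟪B' (B' u), B' v⟫) ∧
      (∀ u ∈ K, (∀ v ∈ K, ⟪B' u, v⟫ - ⟪u, B' v⟫ = 0) → u = 0) := by
  rintro K rfl
  refine ⟨?_, ?_⟩
  · rintro u ⟨_, _, hu⟩ v _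
    rw [hu, inner_neg_left]
    ring
  · rintro u ⟨hu1, hu2, hu3⟩ h
    have hneg : -u ∈ D' := by
      obtain ⟨C, hC⟩ := (hdom u).1 hu1
      refine (hdom _).2 ⟨C, fun d => ?_⟩
      rw [inner_neg_right, abs_neg]
      exact hC d
    have hB : B' (-u) = -(B' u) := by
      refine hdense.eq_of_inner_right ℝ ?_
      intro d hd
      have h1 := hadj ⟨d, hd⟩ (-u) hneg
      have h2 := hadj ⟨d, hd⟩ u hu1
      rw [inner_neg_right, h2] at h1
      rw [inner_neg_right]
      exact h1.symm
    have h0 := h (B' u) ⟨hu2, by rw [hu3]; exact hneg, by rw [hu3, hB]⟩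
    rw [hu3, inner_neg_right, real_inner_self_eq_norm_sq, real_inner_self_eq_norm_sq] at h0
    have h3 : ‖u‖ ^ 2 = 0 := by nlinarith [sq_nonneg ‖u‖, sq_nonneg ‖B' u‖]
    exact norm_eq_zero.1 (pow_eq_zero_iff two_ne_zero |>.1 h3)
end

section
/- Let H be a real Hilbert space and f : ℝ × H → ℝ a map such that each f_λ := f(λ, ·) : H → ℝ is twice continuously (Fréchet) differentiable, the first and second derivatives (λ, u) ↦ Df_λ(u) and (λ, u) ↦ D²f_λ(u) are continuous on ℝ × H, and 0 ∈ H is a critical point of f_λ for every λ (Df_λ(0) = 0). For each λ let L_λ : H → H be the bounded selfadjoint operator determined by ⟨L_λ u, v⟩ = D²f_λ(0)(u, v) for all u, v ∈ H. If λ* ∈ ℝ is a bifurcation point of critical points of f, i.e. every neighbourhood of (λ*, 0) in ℝ × H contains a point (λ, u) with u ≠ 0 and Df_λ(u) = 0, then L_{λ*} is not invertible. -/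
open scoped RealInnerProductSpace

/-- if `λ*` is a bifurcation point of critical points of the family `f` of
`C²` functionals (with `0` a critical point of every `f_λ` and continuously varying first
and second derivatives), then the Riesz representation `L_{λ*}` of the Hessian
`D²f_{λ*}(0)` is not invertible. -/
theorem stmt_11 {H : Type*} [NormedAddCommGroup H] [InnerProductSpace ℝ H]
    [CompleteSpace H]
    (f : ℝ → H → ℝ)
    (hf : Continuous fun p : ℝ × H => f p.1 p.2)
    (hC2 : ∀ lam : ℝ, ContDiff ℝ 2 (f lam))
    (hd1 : Continuous fun p : ℝ × H => fderiv ℝ (f p.1) p.2)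
    (hd2 : Continuous fun p : ℝ × H => fderiv ℝ (fderiv ℝ (f p.1)) p.2)
    (hcrit : ∀ lam : ℝ, fderiv ℝ (f lam) 0 = 0)
    (L : ℝ → H →L[ℝ] H)
    (hL : ∀ (lam : ℝ) (u v : H), ⟪L lam u, v⟫ = fderiv ℝ (fderiv ℝ (f lam)) 0 u v)
    (lam₀ : ℝ)
    (hbif : ∀ U ∈ nhds ((lam₀, 0) : ℝ × H),
      ∃ p ∈ U, p.2 ≠ 0 ∧ fderiv ℝ (f p.1) p.2 = 0) :
    ¬ Function.Bijective (L lam₀) := by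
  intro hbij
  set A := fderiv ℝ (fderiv ℝ (f lam₀)) 0 with hA
  let e := ContinuousLinearEquiv.ofBijective (L lam₀)
    (LinearMap.ker_eq_bot.2 hbij.1) (LinearMap.range_eq_top.2 hbij.2)
  -- bounded inverse
  obtain ⟨K, hK, hKb⟩ : ∃ K : ℝ, 0 < K ∧ ∀ u, ‖u‖ ≤ K * ‖L lam₀ u‖ := by
    refine ⟨‖(e.symm : H →L[ℝ] H)‖ + 1, by positivity, fun u => ?_⟩
    have h1 := (e.symm : H →L[ℝ] H).le_opNorm (L lam₀ u)
    have h2 : (e.symm : H →L[ℝ] H) (L lam₀ u) = u := e.symm_apply_apply u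
    rw [h2] at h1
    nlinarith [norm_nonneg (L lam₀ u)]
  have hLA : ∀ u, ‖L lam₀ u‖ ≤ ‖A u‖ := by
    intro u
    have h1 : ‖L lam₀ u‖ * ‖L lam₀ u‖ ≤ ‖A u‖ * ‖L lam₀ u‖ := by
      rw [← real_inner_self_eq_norm_mul_norm, hL]
      exact (le_abs_self _).trans ((A u).le_opNorm _)
    by_cases h0 : ‖L lam₀ u‖ = 0
    · rw [h0]; positivity
    · exact le_of_mul_le_mul_right h1 (lt_of_le_of_ne (norm_nonneg _) (Ne.symm h0))
  have hcont : ContinuousAt (fun p : ℝ × H => fderiv ℝ (fderiv ℝ (f p.1)) p.2) (lam₀, 0) :=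
    hd2.continuousAt
  obtain ⟨δ, hδ, hball⟩ := (Metric.continuousAt_iff (α := ℝ × H)
    (β := H →L[ℝ] H →L[ℝ] ℝ)).1 hcont
    (1 / (2 * K)) (by positivity)
  obtain ⟨⟨l, u⟩, hp, hu, hdf⟩ := hbif _ (Metric.ball_mem_nhds _ hδ)
  simp only at hu hdf
  rw [Metric.mem_ball, Prod.dist_eq, max_lt_iff] at hp
  have hbound : ∀ x ∈ Metric.ball (0 : H) δ,
      ‖fderiv ℝ (fderiv ℝ (f l)) x - A‖ ≤ 1 / (2 * K) := by
    intro x hx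
    have := hball (x := (l, x)) (by rw [Prod.dist_eq]; exact max_lt hp.1 hx)
    have h5 := dist_eq_norm (E := H →L[ℝ] H →L[ℝ] ℝ) (fderiv ℝ (fderiv ℝ (f l)) x) A
    exact h5.symm.le.trans this.le
  have hdiff : Differentiable ℝ (fderiv ℝ (f l)) :=
    ((hC2 l).fderiv_right (m := 1) (by norm_num)).differentiable (by norm_num)
  have hmv := (convex_ball (0 : H) δ).norm_image_sub_le_of_norm_fderiv_le'
    (fun x _ => hdiff x) hbound (Metric.mem_ball_self hδ) hp.2
  simp only [hdf, hcrit, sub_zero, zero_sub, norm_neg] at hmv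
  have hupos : 0 < ‖u‖ := norm_pos_iff.2 hu
  have h3 : ‖u‖ ≤ K * (1 / (2 * K) * ‖u‖) :=
    (hKb u).trans (mul_le_mul_of_nonneg_left ((hLA u).trans hmv) hK.le)
  have h4 : K * (1 / (2 * K) * ‖u‖) = ‖u‖ / 2 := by field_simp
  linarith
end

section
/- Let r > 0 and let u, v : [0, r] → ℝ be C² functions satisfying −u''(x) − u(x) − u(x)²·v(x)³ = 0 and −v''(x) − v(x) + u(x)³·v(x)² = 0 for all x ∈ [0, r], together with u(0) = v(0) = u(r) = v(r) = 0. Then ∫₀^r (u(x)²·v(x)⁴ + u(x)⁴·v(x)²) dx = 0, and consequently u(x)·v(x) = 0 for every x ∈ [0, r]. -/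
open Set

/-- for the non-variational system `-u'' - u - u²v³ = 0`,
`-v'' - v + u³v² = 0` with Dirichlet boundary conditions on `[0,r]`, the integral
`∫₀^r (u²v⁴ + u⁴v²) dx` vanishes and hence `u·v ≡ 0` on `[0,r]`. -/
theorem stmt_15 (r : ℝ) (hr : 0 < r)
    (u v u' v' u'' v'' : ℝ → ℝ)
    (hu : ∀ x ∈ Icc (0:ℝ) r, HasDerivWithinAt u (u' x) (Icc 0 r) x)
    (hu' : ∀ x ∈ Icc (0:ℝ) r, HasDerivWithinAt u' (u'' x) (Icc 0 r) x)
    (hv : ∀ x ∈ Icc (0:ℝ) r, HasDerivWithinAt v (v' x) (Icc 0 r) x)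
    (hv' : ∀ x ∈ Icc (0:ℝ) r, HasDerivWithinAt v' (v'' x) (Icc 0 r) x)
    (hu''c : ContinuousOn u'' (Icc 0 r))
    (hv''c : ContinuousOn v'' (Icc 0 r))
    (heq1 : ∀ x ∈ Icc (0:ℝ) r, -u'' x - u x - u x ^ 2 * v x ^ 3 = 0)
    (heq2 : ∀ x ∈ Icc (0:ℝ) r, -v'' x - v x + u x ^ 3 * v x ^ 2 = 0)
    (hu0 : u 0 = 0) (hv0 : v 0 = 0) (hur : u r = 0) (hvr : v r = 0) :
    (∫ x in (0:ℝ)..r, (u x ^ 2 * v x ^ 4 + u x ^ 4 * v x ^ 2)) = 0 ∧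
      ∀ x ∈ Icc (0:ℝ) r, u x * v x = 0 := by
  have huc : ContinuousOn u (Icc 0 r) := fun x hx => (hu x hx).continuousWithinAt
  have hvc : ContinuousOn v (Icc 0 r) := fun x hx => (hv x hx).continuousWithinAt
  have hgc : ContinuousOn (fun x => u x ^ 2 * v x ^ 4 + u x ^ 4 * v x ^ 2) (Icc 0 r) :=
    ((huc.pow 2).mul (hvc.pow 4)).add ((huc.pow 4).mul (hvc.pow 2))
  have hW : ∀ x ∈ Icc (0:ℝ) r, HasDerivWithinAt (fun x => u x * v' x - v x * u' x)
      (u x ^ 2 * v x ^ 4 + u x ^ 4 * v x ^ 2) (Icc 0 r) x := by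
    intro x hx
    refine (((hu x hx).mul (hv' x hx)).sub ((hv x hx).mul (hu' x hx))).congr_deriv ?_
    linear_combination v x * heq1 x hx - u x * heq2 x hx
  have hI : (∫ x in (0:ℝ)..r, (u x ^ 2 * v x ^ 4 + u x ^ 4 * v x ^ 2)) = 0 := by
    rw [intervalIntegral.integral_eq_sub_of_hasDerivAt_of_le hr.le
      (f := fun x => u x * v' x - v x * u' x)
      (fun x hx => (hW x hx).continuousWithinAt)
      (fun x hx => (hW x (Ioo_subset_Icc_self hx)).hasDerivAt (Icc_mem_nhds hx.1 hx.2))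
      (hgc.intervalIntegrable_of_Icc hr.le)]
    simp [hu0, hv0, hur, hvr]
  refine ⟨hI, fun x hx => ?_⟩
  by_contra hne
  have := intervalIntegral.integral_pos hr hgc (fun y _ => by positivity) ⟨x, hx, by
    have h1 : u x ≠ 0 := left_ne_zero_of_mul hne
    have h2 : v x ≠ 0 := right_ne_zero_of_mul hne
    positivity⟩
  exact absurd hI this.ne'
end
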